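/- arXiv:2602.09966 — 2 statements merged into one kernel-verified Lean document; each statement's English description precedes it below -/
import Mathlib

section
/- Let X : f = 0 be a reduced surface of degree d ≥ 3 in P³ whose Jacobian algebra M(f) admits a graded free resolution 0 → ⊕_{k=1}^{r} S(1−d−b_k) → ⊕_{j=1}^{q} S(1−d−c_j) → ⊕_{i=1}^{p} S(1−d−d_i) → S(1−d)^4 → S → M(f) → 0. Then X has at most isolated singularities (i.e., the singular locus of X in P³ is finite) if and only if (d−1)² + Σ_{i=1}^{p} d_i² − Σ_{j=1}^{q} c_j² + Σ_{k=1}^{r} b_k² = 0. -/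
open MvPolynomial

noncomputable section

abbrev S4 : Type := MvPolynomial (Fin 4) ℂ

/-- `g` is homogeneous of integer degree `δ`: either `g = 0` or `δ ≥ 0` and `g` homogeneous. -/
def HomogZ (g : S4) (δ : ℤ) : Prop :=
  g = 0 ∨ (0 ≤ δ ∧ g.IsHomogeneous δ.toNat)

/-- The map `S^4 → S` given by the partial derivatives of `f`; its image is the Jacobian ideal. -/
def jacMap (f : S4) : (Fin 4 → S4) →ₗ[S4] S4 where
  toFun v := ∑ i, v i * pderiv i f
  map_add' a b := by simp [add_mul, Finset.sum_add_distrib]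
  map_smul' c a := by simp [Finset.mul_sum, mul_assoc]

/-- The Jacobian ideal of `f`. -/
def jacIdeal (f : S4) : Ideal S4 := Ideal.span (Set.range fun i => pderiv i f)

/-- Hilbert function of the Jacobian algebra `M(f) = S/J_f`: the dimension of its
degree `n` homogeneous component. -/
def hilb (f : S4) (n : ℕ) : ℕ :=
  Module.finrank ℂ
    ((homogeneousSubmodule (Fin 4) ℂ n) ⧸
      (Submodule.comap (homogeneousSubmodule (Fin 4) ℂ n).subtype
        (Submodule.restrictScalars ℂ (jacIdeal f))))

/-- The singular locus of the surface `X : f = 0` in `P³`. -/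
def singLocus (f : S4) : Set (Projectivization ℂ (Fin 4 → ℂ)) :=
  {P | ∀ i, eval P.rep (pderiv i f) = 0}

/-- A graded free resolution of `M(f)` of the shape (res2A). -/
structure JacRes (f : S4) {p q r : ℕ}
    (dd : Fin p → ℕ) (cc : Fin q → ℕ) (bb : Fin r → ℕ) where
  M1 : Matrix (Fin 4) (Fin p) S4
  M2 : Matrix (Fin p) (Fin q) S4
  M3 : Matrix (Fin q) (Fin r) S4
  hM1 : ∀ i a, (M1 i a).IsHomogeneous (dd a)
  hM2 : ∀ a b, HomogZ (M2 a b) ((cc b : ℤ) - (dd a : ℤ))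
  hM3 : ∀ b c, HomogZ (M3 b c) ((bb c : ℤ) - (cc b : ℤ))
  inj : Function.Injective M3.mulVecLin
  ex2 : LinearMap.range M3.mulVecLin = LinearMap.ker M2.mulVecLin
  ex1 : LinearMap.range M2.mulVecLin = LinearMap.ker M1.mulVecLin
  ex0 : LinearMap.range M1.mulVecLin = LinearMap.ker (jacMap f)

/-- Minimality of a resolution: all matrix entries lie in the irrelevant maximal ideal. -/
def JacRes.Minimal {f : S4} {p q r : ℕ} {dd : Fin p → ℕ} {cc : Fin q → ℕ} {bb : Fin r → ℕ}
    (R : JacRes f dd cc bb) : Prop :=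
  (∀ i a, constantCoeff (R.M1 i a) = 0) ∧ (∀ a b, constantCoeff (R.M2 a b) = 0) ∧
    (∀ b c, constantCoeff (R.M3 b c) = 0)


abbrev HH (n : ℕ) : Submodule ℂ S4 := homogeneousSubmodule (Fin 4) ℂ n

instance HH_fin (n : ℕ) : Module.Finite ℂ (HH n) :=
  Module.Finite.iff_fg.2 (homogeneousSubmodule_fg _ _ n)

lemma finrank_HH (n : ℕ) : Module.finrank ℂ (HH n) = (n + 3).choose 3 := by
  have e : HH n ≃ₗ[ℂ] ({d : Fin 4 →₀ ℕ | d.degree = n} →₀ ℂ) := by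
    unfold HH
    rw [homogeneousSubmodule_eq_finsupp_supported]
    exact AddMonoidAlgebra.supportedEquivFinsupp _
  have hs : {d : Fin 4 →₀ ℕ | d.degree = n} = ↑(Finset.finsuppAntidiag (Finset.univ : Finset (Fin 4)) n) := by
    ext d
    simp [Finset.mem_finsuppAntidiag, Finsupp.degree_eq_sum]
  rw [e.finrank_eq, hs]
  have := Finset.card_finsuppAntidiag_nat_eq_choose (s := (Finset.univ : Finset (Fin 4))) n
  rw [Module.finrank_finsupp_self]
  simp [this]
  rw [add_comm 3 n, Nat.choose_symm_add]

lemma finrank_split {E F : Type*} [AddCommGroup E] [AddCommGroup F] [Module ℂ E] [Module ℂ F]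
    (L : E →ₗ[ℂ] F) (V : Submodule ℂ E) [Module.Finite ℂ V] :
    Module.finrank ℂ V = Module.finrank ℂ (V.map L)
      + Module.finrank ℂ (V ⊓ LinearMap.ker L : Submodule ℂ E) := by
  rw [← LinearMap.finrank_range_add_finrank_ker (L.domRestrict V), LinearMap.range_domRestrict,
    LinearMap.ker_domRestrict, ← Submodule.map_comap_subtype, Submodule.finrank_map_subtype_eq]

lemma hc_mul {g w : S4} {k n : ℕ} (hg : g.IsHomogeneous k) :
    homogeneousComponent (k + n) (g * w) = g * homogeneousComponent n w := by
  let _ := MvPolynomial.gradedAlgebra (σ := Fin 4) (R := ℂ)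
  have := DirectSum.coe_decompose_mul_add_of_left_mem (homogeneousSubmodule (Fin 4) ℂ) (i := k) (j := n)
    (a := g) (b := w) hg
  rw [← decomposition.decompose'_apply, ← decomposition.decompose'_apply]
  exact this

def PP {ι : Type*} (α : ι → ℕ) (m : ℕ) : Submodule ℂ (ι → S4) :=
  Submodule.pi Set.univ (fun a => HH (m - α a))

lemma mem_PP {ι : Type*} (α : ι → ℕ) (m : ℕ) (v : ι → S4) :
    v ∈ PP α m ↔ ∀ a, (v a).IsHomogeneous (m - α a) := by
  simp [PP, Submodule.mem_pi]

def PPequiv {ι : Type*} (α : ι → ℕ) (m : ℕ) : PP α m ≃ₗ[ℂ] (∀ a, HH (m - α a)) where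
  toFun v a := ⟨v.1 a, (mem_PP α m v.1).1 v.2 a⟩
  invFun v := ⟨fun a => (v a).1, (mem_PP α m _).2 fun a => (v a).2⟩
  map_add' _ _ := rfl
  map_smul' _ _ := rfl
  left_inv _ := rfl
  right_inv _ := rfl

instance PP_fin {ι : Type*} [Fintype ι] (α : ι → ℕ) (m : ℕ) : Module.Finite ℂ (PP α m) :=
  Module.Finite.equiv (PPequiv α m).symm

lemma finrank_PP {ι : Type*} [Fintype ι] (α : ι → ℕ) (m : ℕ) :
    Module.finrank ℂ (PP α m) = ∑ a, (m - α a + 3).choose 3 := by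
  rw [(PPequiv α m).finrank_eq, Module.finrank_pi_fintype]
  simp [finrank_HH]

lemma map_PP {ι κ : Type*} [Fintype ι] [Fintype κ] (M : Matrix ι κ S4) (α : ι → ℕ) (β : κ → ℕ)
    (hM : ∀ i k, HomogZ (M i k) ((β k : ℤ) - (α i : ℤ))) (m : ℕ) (hβ : ∀ k, β k ≤ m) :
    (PP β m).map (M.mulVecLin.restrictScalars ℂ) =
      PP α m ⊓ (LinearMap.range M.mulVecLin).restrictScalars ℂ := by
  have key : ∀ i k, M i k = 0 ∨ ∃ δ, (M i k).IsHomogeneous δ ∧ m - α i = δ + (m - β k) := by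
    intro i k
    rcases hM i k with h | ⟨h, h'⟩
    · exact Or.inl h
    · refine Or.inr ⟨_, h', ?_⟩
      have := hβ k
      omega
  apply le_antisymm
  · rintro _ ⟨w, hw, rfl⟩
    have hw' := (mem_PP _ _ _).1 hw
    refine ⟨(mem_PP _ _ _).2 fun i => ?_, ⟨w, rfl⟩⟩
    simp only [LinearMap.coe_restrictScalars, Matrix.mulVecLin_apply, Matrix.mulVec, dotProduct]
    refine IsHomogeneous.sum _ _ _ fun k _ => ?_
    rcases key i k with h | ⟨δ, h, h'⟩
    · rw [h, zero_mul]; exact isHomogeneous_zero _ _ _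
    · rw [h']; exact h.mul (hw' k)
  · rintro v ⟨hv, ⟨w, rfl⟩⟩
    have hv' := (mem_PP _ _ _).1 hv
    refine ⟨fun k => homogeneousComponent (m - β k) (w k),
      (mem_PP _ _ _).2 fun k => homogeneousComponent_isHomogeneous _ _, ?_⟩
    ext1 i
    rw [← homogeneousComponent_eq_self (hv' i)]
    simp only [LinearMap.coe_restrictScalars, Matrix.mulVecLin_apply, Matrix.mulVec, dotProduct,
      map_sum]
    refine Finset.sum_congr rfl fun k _ => ?_
    rcases key i k with h | ⟨δ, h, h'⟩
    · simp [h]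
    · rw [h', hc_mul h]

lemma step_PP {ι κ : Type*} [Fintype ι] [Fintype κ] (M : Matrix ι κ S4) (α : ι → ℕ) (β : κ → ℕ)
    (hM : ∀ i k, HomogZ (M i k) ((β k : ℤ) - (α i : ℤ))) (m : ℕ) (hβ : ∀ k, β k ≤ m) :
    ∑ a, (m - β a + 3).choose 3 =
      Module.finrank ℂ (PP α m ⊓ (LinearMap.range M.mulVecLin).restrictScalars ℂ : Submodule ℂ _)
      + Module.finrank ℂ (PP β m ⊓ (LinearMap.ker M.mulVecLin).restrictScalars ℂ : Submodule ℂ _) := by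
  rw [← map_PP M α β hM m hβ, ← finrank_PP]
  exact finrank_split _ _

abbrev JJ (f : S4) (n : ℕ) : Submodule ℂ S4 :=
  HH n ⊓ (jacIdeal f).restrictScalars ℂ

lemma hilb_add (f : S4) (n : ℕ) :
    hilb f n + Module.finrank ℂ (JJ f n) = (n + 3).choose 3 := by
  rw [← finrank_HH, ← Submodule.finrank_quotient_add_finrank (Submodule.comap (HH n).subtype
        (Submodule.restrictScalars ℂ (jacIdeal f)))]
  congr 1
  rw [JJ, ← Submodule.map_comap_subtype, Submodule.finrank_map_subtype_eq]

lemma jac_range (f : S4) : LinearMap.range (jacMap f) = jacIdeal f := by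
  apply le_antisymm
  · rintro _ ⟨v, rfl⟩
    refine Submodule.sum_mem (jacIdeal f) (t := Finset.univ) (f := fun i => v i * pderiv i f) fun i _ => (jacIdeal f).mul_mem_left _ (Ideal.subset_span (Set.mem_range_self i))
  · refine Ideal.span_le.2 ?_
    rintro _ ⟨i, rfl⟩
    exact ⟨Pi.single i 1, by simp [jacMap, Pi.single_apply]⟩

lemma map_jac {f : S4} {e : ℕ} (hf : ∀ i, (pderiv i f).IsHomogeneous e) (m : ℕ) (hm : e ≤ m) :
    (PP (fun _ : Fin 4 => e) m).map ((jacMap f).restrictScalars ℂ) = JJ f m := by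
  rw [JJ, ← jac_range]
  have hme : m = e + (m - e) := by omega
  apply le_antisymm
  · rintro _ ⟨w, hw, rfl⟩
    have hw' := (mem_PP _ _ _).1 hw
    refine ⟨?_, ⟨w, rfl⟩⟩
    refine IsHomogeneous.sum _ _ _ fun k _ => ?_
    rw [mul_comm]
    have := (hf k).mul (hw' k)
    rwa [← hme] at this
  · rintro v ⟨hv, ⟨w, rfl⟩⟩
    refine ⟨fun k => homogeneousComponent (m - e) (w k),
      (mem_PP _ _ _).2 fun k => homogeneousComponent_isHomogeneous _ _, ?_⟩
    rw [← homogeneousComponent_eq_self hv]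
    simp only [LinearMap.coe_restrictScalars, jacMap, LinearMap.coe_mk, AddHom.coe_mk, map_sum]
    refine Finset.sum_congr rfl fun k _ => ?_
    rw [mul_comm, mul_comm (w k), ← hc_mul (hf k), ← hme]

lemma HomogZ_shift {g : S4} {a b : ℕ} (e : ℕ) (h : HomogZ g ((a : ℤ) - b)) :
    HomogZ g (((e + a : ℕ) : ℤ) - ((e + b : ℕ) : ℤ)) := by
  convert h using 1; push_cast; ring

lemma euler_char {f : S4} {e : ℕ} (hf : ∀ i, (pderiv i f).IsHomogeneous e)
    {p q r : ℕ} {dd : Fin p → ℕ} {cc : Fin q → ℕ} {bb : Fin r → ℕ} (R : JacRes f dd cc bb)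
    (n : ℕ) (hn : e ≤ n) (h1 : ∀ i, e + dd i ≤ n) (h2 : ∀ i, e + cc i ≤ n)
    (h3 : ∀ i, e + bb i ≤ n) :
    hilb f n + 4 * (n - e + 3).choose 3 + ∑ j, (n - (e + cc j) + 3).choose 3
     = (n + 3).choose 3 + ∑ i, (n - (e + dd i) + 3).choose 3
        + ∑ k, (n - (e + bb k) + 3).choose 3 := by
  have e0 := hilb_add f n
  have s0 := finrank_split ((jacMap f).restrictScalars ℂ) (PP (fun _ : Fin 4 => e) n)
  rw [map_jac hf n hn, finrank_PP] at s0
  have s1 := step_PP R.M1 (fun _ : Fin 4 => e) (fun a => e + dd a)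
    (fun i a => Or.inr ⟨by simp, by simpa using R.hM1 i a⟩) n h1
  have s2 := step_PP R.M2 (fun a => e + dd a) (fun a => e + cc a)
    (fun i a => HomogZ_shift e (R.hM2 i a)) n h2
  have s3 := step_PP R.M3 (fun a => e + cc a) (fun a => e + bb a)
    (fun i a => HomogZ_shift e (R.hM3 i a)) n h3
  rw [R.ex0] at s1
  rw [R.ex1] at s2
  rw [R.ex2, LinearMap.ker_eq_bot.2 R.inj] at s3
  have s0' : LinearMap.ker ((jacMap f).restrictScalars ℂ) = (LinearMap.ker (jacMap f)).restrictScalars ℂ := rfl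
  rw [s0'] at s0
  have hz : (PP (fun a => e + bb a) n ⊓ (⊥ : Submodule S4 (Fin r → S4)).restrictScalars ℂ :
      Submodule ℂ (Fin r → S4)) = ⊥ := by
    rw [eq_bot_iff]
    rintro x ⟨_, hx⟩
    exact hx
  rw [hz, finrank_bot] at s3
  simp only [Finset.sum_const, Finset.card_univ, Fintype.card_fin, smul_eq_mul] at s0
  omega

lemma linform (φ : (Fin 4 → ℂ) →ₗ[ℂ] ℂ) :
    ∃ l : S4, l.IsHomogeneous 1 ∧ ∀ x, eval x l = φ x := by
  refine ⟨∑ i, C (φ (Pi.single i 1)) * X i, ?_, fun x => ?_⟩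
  · exact IsHomogeneous.sum _ _ _ fun i _ => isHomogeneous_C_mul_X _ _
  · conv_rhs => rw [← Finset.univ_sum_single x]
    simp only [map_sum, map_mul, eval_C, eval_X]
    refine Finset.sum_congr rfl fun i _ => ?_
    rw [show (Pi.single i (x i) : Fin 4 → ℂ) = x i • Pi.single i 1 by
      rw [← Pi.single_smul]; simp, map_smul, smul_eq_mul, mul_comm]

lemma eval_homog_smul {g : S4} {n : ℕ} (hg : g.IsHomogeneous n) (a : ℂ) (x : Fin 4 → ℂ) :
    eval (a • x) g = a ^ n * eval x g := by
  rw [eval_eq', eval_eq', Finset.mul_sum]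
  refine Finset.sum_congr rfl fun m hm => ?_
  have : ∑ i, m i = n := by
    rw [← Finsupp.degree_eq_sum]; exact (hg.degree_eq_sum_deg_support hm).symm
  simp only [Pi.smul_apply, smul_eq_mul, mul_pow, Finset.prod_mul_distrib, Finset.prod_pow_eq_pow_sum,
    this]
  ring

lemma jac_homog {f : S4} {e : ℕ} (hf : ∀ i, (pderiv i f).IsHomogeneous e) {g : S4}
    (hg : g ∈ jacIdeal f) (n : ℕ) : homogeneousComponent n g ∈ jacIdeal f := by
  let _ := MvPolynomial.gradedAlgebra (σ := Fin 4) (R := ℂ)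
  refine homogeneousComponent_mem_of_mem ?_ hg n
  apply Ideal.homogeneous_span
  rintro _ ⟨i, rfl⟩
  exact ⟨e, hf i⟩

lemma hilb_le_of_surj (f : S4) (l : S4) (hl : l.IsHomogeneous 1) (n : ℕ)
    (h : ∀ g : S4, g.IsHomogeneous (n + 1) → ∃ u : S4, u.IsHomogeneous n ∧ g - l * u ∈ jacIdeal f) :
    hilb f (n + 1) ≤ hilb f n := by
  let μ : HH n →ₗ[ℂ] HH (n + 1) := (LinearMap.mulLeft ℂ l).restrict (p := HH n) (q := HH (n + 1)) (by
    intro x hx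
    have := hl.mul hx
    rw [add_comm] at this
    exact this)
  let Q := Submodule.mapQ (Submodule.comap (HH n).subtype (Submodule.restrictScalars ℂ (jacIdeal f)))
    (Submodule.comap (HH (n + 1)).subtype (Submodule.restrictScalars ℂ (jacIdeal f))) μ (by
      intro x hx
      exact (jacIdeal f).mul_mem_left l hx)
  have hQ : Function.Surjective Q := by
    intro y
    obtain ⟨g, rfl⟩ := Submodule.Quotient.mk_surjective _ y
    obtain ⟨u, hu, hu'⟩ := h g.1 g.2
    refine ⟨Submodule.Quotient.mk ⟨u, hu⟩, ?_⟩
    symm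
    refine (Submodule.Quotient.eq _).2 ?_
    exact hu'
  exact LinearMap.finrank_le_finrank_of_surjective hQ

lemma finite_bounded {f : S4} {e : ℕ} (hf : ∀ i, (pderiv i f).IsHomogeneous e)
    (hfin : (singLocus f).Finite) : ∃ B, ∀ n, hilb f n ≤ B := by
  classical
  -- choose a linear form missing the singular locus
  obtain ⟨φ, hφ⟩ : ∃ φ : (Fin 4 → ℂ) →ₗ[ℂ] ℂ, ∀ P ∈ singLocus f, φ P.rep ≠ 0 := by
    have := Subspace.biUnion_ne_univ_of_top_notMem (k := ℂ) (E := (Fin 4 → ℂ) →ₗ[ℂ] ℂ)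
      (s := hfin.toFinset.image fun P => LinearMap.ker (LinearMap.applyₗ (R := ℂ) (M₂ := ℂ) P.rep)) (by
        intro h
        obtain ⟨P, _, hP⟩ := Finset.mem_image.1 h
        apply P.rep_nonzero
        funext i
        have : LinearMap.proj i ∈ LinearMap.ker (LinearMap.applyₗ (R := ℂ) (M₂ := ℂ) P.rep) := by
          rw [hP]; trivial
        simpa using this)
    rw [Set.ne_univ_iff_exists_notMem] at this
    obtain ⟨φ, hφ⟩ := this
    refine ⟨φ, fun P hP h0 => hφ ?_⟩
    simp only [Set.mem_iUnion]
    exact ⟨_, Finset.mem_image.2 ⟨P, hfin.mem_toFinset.2 hP, rfl⟩, by simpa using h0⟩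
  obtain ⟨l, hl, hle⟩ := linform φ
  let I : Ideal S4 := jacIdeal f ⊔ Ideal.span {l}
  have hz : ∀ x ∈ zeroLocus ℂ I, x = 0 := by
    intro x hx
    by_contra hx0
    have hx1 : ∀ i, eval x (pderiv i f) = 0 := fun i =>
      hx _ (Ideal.mem_sup_left (Ideal.subset_span ⟨i, rfl⟩))
    have hx2 : φ x = 0 := by
      rw [← hle]
      exact hx _ (Ideal.mem_sup_right (Ideal.subset_span rfl))
    obtain ⟨a, ha⟩ := Projectivization.exists_smul_eq_mk_rep ℂ x hx0
    have ha' : (a : ℂ) • x = (Projectivization.mk ℂ x hx0).rep := ha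
    refine hφ (Projectivization.mk ℂ x hx0) (fun i => ?_) ?_
    · rw [← ha', eval_homog_smul (hf i), hx1, mul_zero]
    · rw [← ha', map_smul, hx2, smul_zero]
  have hrad : idealOfVars (Fin 4) ℂ ≤ I.radical := by
    rw [← vanishingIdeal_zeroLocus_eq_radical (K := ℂ)]
    refine Ideal.span_le.2 ?_
    rintro _ ⟨i, rfl⟩ x hx
    simp [hz x hx]
  obtain ⟨N, hN⟩ := Ideal.exists_pow_le_of_le_radical_of_fg hrad (idealOfVars_fg _ _)
  have step : ∀ n, N ≤ n → hilb f (n + 1) ≤ hilb f n := by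
    intro n hn
    refine hilb_le_of_surj f l hl n fun g hg => ?_
    have hgI : g ∈ I := hN ((mem_pow_idealOfVars_iff N g).2 fun m hm => by
      have : n + 1 = m.degree := hg.degree_eq_sum_deg_support hm
      omega)
    obtain ⟨j, hj, k, hk, rfl⟩ := Submodule.mem_sup.1 hgI
    obtain ⟨u, rfl⟩ := Ideal.mem_span_singleton.1 hk
    refine ⟨homogeneousComponent n u, homogeneousComponent_isHomogeneous _ _, ?_⟩
    have h1 := homogeneousComponent_eq_self hg
    rw [← h1, map_add, add_comm n 1, hc_mul hl, add_sub_cancel_right]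
    exact jac_homog hf hj _
  have hmono : ∀ k, hilb f (N + k) ≤ hilb f N := by
    intro k
    induction k with
    | zero => exact le_rfl
    | succ k ih => exact (step (N + k) (by omega)).trans ih
  refine ⟨∑ i ∈ Finset.range (N + 1), hilb f i, fun n => ?_⟩
  by_cases h : n ≤ N
  · exact Finset.single_le_sum (f := hilb f) (fun _ _ => Nat.zero_le _) (Finset.mem_range.2 (by omega))
  · have := hmono (n - N)
    rw [show N + (n - N) = n by omega] at this
    exact this.trans (Finset.single_le_sum (f := hilb f) (fun _ _ => Nat.zero_le _) (Finset.mem_range.2 (by omega)))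

lemma sep_form (t : Finset (Projectivization ℂ (Fin 4 → ℂ))) (P : Projectivization ℂ (Fin 4 → ℂ))
    (hP : P ∈ t) (n : ℕ) (hn : t.card ≤ n) :
    ∃ g : S4, g.IsHomogeneous n ∧ eval P.rep g ≠ 0 ∧ ∀ Q ∈ t, Q ≠ P → eval Q.rep g = 0 := by
  classical
  have h1 : ∀ Q : Projectivization ℂ (Fin 4 → ℂ), ∃ l : S4, l.IsHomogeneous 1 ∧
      eval P.rep l ≠ 0 ∧ (Q ≠ P → eval Q.rep l = 0) := by
    intro Q
    by_cases hQ : Q = P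
    · obtain ⟨φ, hφ, -⟩ := Submodule.exists_le_ker_of_notMem (K := ℂ) (p := ⊥) (v := P.rep)
        (by simpa using P.rep_nonzero)
      obtain ⟨l, hl, hle⟩ := linform φ
      exact ⟨l, hl, by rwa [hle], fun h => absurd hQ h⟩
    · obtain ⟨φ, hφ, hk⟩ := Submodule.exists_le_ker_of_notMem (K := ℂ) (p := ℂ ∙ Q.rep) (v := P.rep)
        (by
          intro hmem
          obtain ⟨a, ha⟩ := Submodule.mem_span_singleton.1 hmem
          apply hQ
          rw [← Q.mk_rep, ← P.mk_rep, eq_comm, Projectivization.mk_eq_mk_iff']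
          exact ⟨a, ha⟩)
      obtain ⟨l, hl, hle⟩ := linform φ
      refine ⟨l, hl, by rwa [hle], fun _ => ?_⟩
      rw [hle]
      exact hk (Submodule.mem_span_singleton_self _)
  choose l hl hl1 hl2 using h1
  refine ⟨(∏ Q ∈ t, if Q = P then 1 else l Q) * l P ^ (n - (t.erase P).card), ?_, ?_, ?_⟩
  · have e1 : (∏ Q ∈ t, if Q = P then 1 else l Q) = ∏ Q ∈ t.erase P, l Q := by
      rw [← Finset.mul_prod_erase t _ hP, if_pos rfl, one_mul]
      exact Finset.prod_congr rfl fun Q hQ => if_neg (Finset.ne_of_mem_erase hQ)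
    have h := (IsHomogeneous.prod (t.erase P) l (fun _ => 1) fun Q _ => hl Q).mul
      ((hl P).pow (n - (t.erase P).card))
    rw [e1]
    convert h using 1
    have := Finset.card_erase_le (s := t) (a := P)
    simp only [Finset.sum_const, smul_eq_mul, mul_one, one_mul]
    omega
  · rw [map_mul, map_pow, map_prod]
    refine mul_ne_zero (Finset.prod_ne_zero_iff.2 fun Q _ => ?_) (pow_ne_zero _ (hl1 P))
    split_ifs
    · simp
    · exact hl1 Q
  · intro Q hQ hne
    rw [map_mul, map_prod, Finset.prod_eq_zero hQ, zero_mul]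
    rw [if_neg hne]
    exact hl2 Q hne

lemma hilb_ge_card (f : S4) (t : Finset (Projectivization ℂ (Fin 4 → ℂ)))
    (ht : (t : Set _) ⊆ singLocus f) (n : ℕ) (hn : t.card ≤ n) : t.card ≤ hilb f n := by
  classical
  let ev : HH n →ₗ[ℂ] (t → ℂ) :=
    { toFun := fun g P => eval P.1.rep g.1
      map_add' := fun a b => by ext; simp
      map_smul' := fun a b => by ext; simp [smul_eval] }
  have hev : Submodule.comap (HH n).subtype (Submodule.restrictScalars ℂ (jacIdeal f)) ≤
      LinearMap.ker ev := by
    intro g hg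
    have hg' : g.1 ∈ jacIdeal f := hg
    rw [LinearMap.mem_ker]
    ext P
    have hle : jacIdeal f ≤ RingHom.ker (eval P.1.rep) := by
      refine Ideal.span_le.2 ?_
      rintro _ ⟨i, rfl⟩
      exact ht P.2 i
    exact hle hg'
  have hsurj : Function.Surjective ev := by
    rw [← LinearMap.range_eq_top, eq_top_iff]
    intro v _
    rw [← Finset.univ_sum_single v]
    refine Submodule.sum_mem _ fun P _ => ?_
    obtain ⟨g, hg, h1, h2⟩ := sep_form t P.1 P.2 n hn
    refine ⟨(v P / eval P.1.rep g) • ⟨g, hg⟩, ?_⟩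
    rw [map_smul]
    ext Q
    by_cases hQ : Q = P
    · subst hQ
      simp [ev, h1]
    · have : (Q : Projectivization ℂ (Fin 4 → ℂ)) ≠ P := fun h => hQ (Subtype.ext h)
      simp [ev, h2 Q.1 Q.2 this, hQ]
  have hs2 : Function.Surjective (Submodule.liftQ _ ev hev) := by
    intro v
    obtain ⟨g, rfl⟩ := hsurj v
    exact ⟨Submodule.Quotient.mk g, rfl⟩
  have := LinearMap.finrank_le_finrank_of_surjective hs2
  rw [Module.finrank_fintype_fun_eq_card, Fintype.card_coe] at this
  exact this

lemma bounded_finite (f : S4) (B N : ℕ) (hB : ∀ n, N ≤ n → hilb f n ≤ B) : (singLocus f).Finite := by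
  by_contra h
  obtain ⟨t, ht, hc⟩ := Set.Infinite.exists_subset_card_eq h (B + 1)
  have h1 := hilb_ge_card f t ht (N + (B + 1)) (by omega)
  have h2 := hB (N + (B + 1)) (by omega)
  omega

lemma unit_of_dvd_pderiv {h : S4} (h0 : h ≠ 0) (hd : ∀ i, h ∣ pderiv i h) : IsUnit h := by
  by_cases hN : h.totalDegree = 0
  · rw [totalDegree_eq_zero_iff_eq_C] at hN
    rw [hN]
    refine IsUnit.map C (isUnit_iff_ne_zero.2 fun hc => h0 ?_)
    rw [hN, hc, C_0]
  exfalso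
  obtain ⟨m, hm, hmd⟩ : ∃ m ∈ h.support, m.degree = h.totalDegree := by
    obtain ⟨m, hm, hmd⟩ := Finset.exists_mem_eq_sup h.support (support_nonempty.2 h0)
      (fun s => s.sum fun _ e => e)
    exact ⟨m, hm, hmd.symm⟩
  obtain ⟨i, hi⟩ : ∃ i, m i ≠ 0 := by
    by_contra hcon
    push Not at hcon
    apply hN
    rw [← hmd, show m = 0 from Finsupp.ext hcon]
    simp
  have hmm : m - Finsupp.single i 1 + Finsupp.single i 1 = m := by
    ext j
    by_cases hj : j = i
    · subst hj; simp; omega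
    · simp [Ne.symm hj]
  have hne : pderiv i h ≠ 0 := by
    intro hz
    have := coeff_pderiv (i := i) h (m - Finsupp.single i 1)
    rw [hz, hmm, coeff_zero] at this
    have h2 := mem_support_iff.1 hm
    have h3 : ((((m - Finsupp.single i 1 : Fin 4 →₀ ℕ) i : ℕ) : ℂ) + 1) ≠ 0 :=
      Nat.cast_add_one_ne_zero _
    exact mul_ne_zero h2 h3 this.symm
  obtain ⟨k, hk⟩ := hd i
  have hk0 : k ≠ 0 := by rintro rfl; exact hne (by rw [hk, mul_zero])
  have h1 : h.totalDegree ≤ (pderiv i h).totalDegree := by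
    rw [hk, totalDegree_mul_of_isDomain h0 hk0]; omega
  have h2 : (pderiv i h).totalDegree + 1 ≤ h.totalDegree := by
    obtain ⟨s, hs, hsd⟩ := Finset.exists_mem_eq_sup (pderiv i h).support (support_nonempty.2 hne)
      (fun s => s.sum fun _ e => e)
    have hsd' : (pderiv i h).totalDegree = s.degree := hsd
    have hs' := mem_support_iff.1 hs
    rw [coeff_pderiv] at hs'
    have hs2 : s + Finsupp.single i 1 ∈ h.support := by
      rw [mem_support_iff]
      intro hz; rw [hz] at hs'; simp at hs'
    have h3 : (s + Finsupp.single i 1).degree ≤ h.totalDegree := le_totalDegree hs2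
    rw [map_add, Finsupp.degree_single] at h3
    omega
  omega

lemma no_common_prime {f : S4} {d : ℕ} (hd : d ≠ 0) (hhom : f.IsHomogeneous d) (hred : Squarefree f)
    {h : S4} (hh : Prime h) (hall : ∀ i, h ∣ pderiv i f) : False := by
  have hf : h ∣ f := by
    have h1 : h ∣ d • f := by
      rw [← hhom.sum_X_mul_pderiv]
      exact Finset.dvd_sum fun i _ => (hall i).mul_left _
    have h2 : f = C ((d : ℂ)⁻¹) * (d • f) := by
      rw [nsmul_eq_mul, ← mul_assoc, ← map_natCast C, ← C_mul,
        inv_mul_cancel₀ (Nat.cast_ne_zero.2 hd), C_1, one_mul]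
    rw [h2]
    exact h1.mul_left _
  obtain ⟨g, rfl⟩ := hf
  have hg : ¬ h ∣ g := by
    rintro ⟨k, rfl⟩
    exact hh.not_isUnit (hred h ⟨k, by ring⟩)
  refine hh.not_isUnit (unit_of_dvd_pderiv hh.ne_zero fun i => ?_)
  have h1 := hall i
  rw [pderiv_mul] at h1
  have h2 : h ∣ pderiv i h * g := (dvd_add_left (dvd_mul_right h _)).1 h1
  exact (hh.dvd_or_dvd h2).resolve_right hg

lemma exists_coprime {f : S4} {d : ℕ} (hd : d ≠ 0) (hhom : f.IsHomogeneous d) (hred : Squarefree f) :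
    ∃ a b : S4, a.IsHomogeneous (d - 1) ∧ b.IsHomogeneous (d - 1) ∧ a ∈ jacIdeal f ∧
      b ∈ jacIdeal f ∧ a ≠ 0 ∧ b ≠ 0 ∧ IsRelPrime a b := by
  classical
  have hX : Prime (X 0 : S4) := X_prime
  obtain ⟨i0, hi0⟩ : ∃ i, pderiv i f ≠ 0 := by
    by_contra hcon
    push Not at hcon
    exact no_common_prime hd hhom hred hX fun i => by rw [hcon i]; exact dvd_zero _
  set a := pderiv i0 f with ha
  let ψ : (Fin 4 → ℂ) →ₗ[ℂ] S4 :=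
    { toFun := fun c => ∑ i, c i • pderiv i f
      map_add' := fun x y => by simp [add_smul, Finset.sum_add_distrib]
      map_smul' := fun x y => by simp [mul_smul, Finset.smul_sum] }
  have hψ1 : ∀ i, ψ (Pi.single i 1) = pderiv i f := fun i => by
    simp [ψ, Pi.single_apply]
  let W : S4 → Submodule ℂ (Fin 4 → ℂ) := fun h =>
    Submodule.comap ψ ((Ideal.span {h}).restrictScalars ℂ)
  have hWm : ∀ h c, c ∈ W h ↔ h ∣ ψ c := fun h c => Ideal.mem_span_singleton
  have hW : ∀ h : S4, Prime h → W h ≠ ⊤ := by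
    intro h hh htop
    refine no_common_prime hd hhom hred hh fun i => ?_
    rw [← hψ1, ← hWm, htop]; trivial
  have := Subspace.biUnion_ne_univ_of_top_notMem (k := ℂ) (E := Fin 4 → ℂ)
    (s := (insert (X 0) (UniqueFactorizationMonoid.factors a).toFinset).image W) (by
      intro h
      obtain ⟨P, hP, hP'⟩ := Finset.mem_image.1 h
      refine hW P ?_ hP'
      rcases Finset.mem_insert.1 hP with rfl | hP
      · exact hX
      · exact UniqueFactorizationMonoid.prime_of_factor P (Multiset.mem_toFinset.1 hP))
  rw [Set.ne_univ_iff_exists_notMem] at this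
  obtain ⟨c, hc⟩ := this
  simp only [Set.mem_iUnion, not_exists] at hc
  have hc' : ∀ h ∈ insert (X 0) (UniqueFactorizationMonoid.factors a).toFinset, ¬ h ∣ ψ c := by
    intro h hh hdv
    exact hc (W h) (Finset.mem_image_of_mem _ hh) ((hWm h c).2 hdv)
  refine ⟨a, ψ c, hhom.pderiv, ?_, ?_, ?_, hi0, ?_, ?_⟩
  · refine IsHomogeneous.sum _ _ _ fun i _ => ?_
    rw [smul_eq_C_mul]
    exact hhom.pderiv.C_mul _
  · exact Ideal.subset_span ⟨i0, rfl⟩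
  · refine Submodule.sum_mem (jacIdeal f) (t := Finset.univ) (f := fun i => c i • pderiv i f)
      fun i _ => ?_
    rw [smul_eq_C_mul]
    exact (jacIdeal f).mul_mem_left _ (Ideal.subset_span (Set.mem_range_self i))
  · intro h0
    exact hc' (X 0) (Finset.mem_insert_self _ _) (by rw [h0]; exact dvd_zero _)
  · rw [UniqueFactorizationMonoid.isRelPrime_iff_no_prime_factors hi0]
    intro q hqa hqb hq
    obtain ⟨q', hq', hass⟩ := UniqueFactorizationMonoid.exists_mem_factors_of_dvd hi0 hq.irreducible hqa
    exact hc' q' (Finset.mem_insert_of_mem (Multiset.mem_toFinset.2 hq')) (hass.symm.dvd.trans hqb)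

lemma finrank_mul (a : S4) (ha : a ≠ 0) (n : ℕ) :
    Module.finrank ℂ ((HH n).map (LinearMap.mulLeft ℂ a)) = (n + 3).choose 3 := by
  rw [← finrank_HH]
  have hinj : Function.Injective (LinearMap.mulLeft ℂ a) := mul_right_injective₀ ha
  exact (Submodule.equivMapOfInjective _ hinj (HH n)).finrank_eq.symm

lemma lin_bound {f : S4} {d : ℕ} (hd : d ≠ 0) (hhom : f.IsHomogeneous d) (hred : Squarefree f)
    (n : ℕ) (hn : 2 * (d - 1) ≤ n) :
    hilb f n + 2 * (n - (d - 1) + 3).choose 3 ≤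
      (n + 3).choose 3 + (n - 2 * (d - 1) + 3).choose 3 := by
  obtain ⟨a, b, ha, hb, haJ, hbJ, ha0, hb0, hab⟩ := exists_coprime hd hhom hred
  set e := d - 1
  let A := (HH (n - e)).map (LinearMap.mulLeft ℂ a)
  let B := (HH (n - e)).map (LinearMap.mulLeft ℂ b)
  let AB := (HH (n - 2 * e)).map (LinearMap.mulLeft ℂ (a * b))
  have hA : Module.finrank ℂ A = (n - e + 3).choose 3 := finrank_mul a ha0 _
  have hB : Module.finrank ℂ B = (n - e + 3).choose 3 := finrank_mul b hb0 _
  have hAB : Module.finrank ℂ AB = (n - 2 * e + 3).choose 3 := finrank_mul _ (mul_ne_zero ha0 hb0) _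
  have hsup : A ⊔ B ≤ JJ f n := by
    have hne : n = e + (n - e) := by omega
    refine sup_le ?_ ?_
    · rintro _ ⟨u, hu, rfl⟩
      refine ⟨?_, (jacIdeal f).mul_mem_right _ haJ⟩
      have := ha.mul hu
      rwa [← hne] at this
    · rintro _ ⟨u, hu, rfl⟩
      refine ⟨?_, (jacIdeal f).mul_mem_right _ hbJ⟩
      have := hb.mul hu
      rwa [← hne] at this
  have hinf : A ⊓ B ≤ AB := by
    rintro _ ⟨⟨u, hu, rfl⟩, ⟨v, hv, huv⟩⟩
    have huv' : b * v = a * u := huv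
    have hdv : b ∣ u := hab.symm.dvd_of_dvd_mul_left ⟨v, huv'.symm⟩
    obtain ⟨w, rfl⟩ := hdv
    refine ⟨homogeneousComponent (n - 2 * e) w, homogeneousComponent_isHomogeneous _ _, ?_⟩
    have h1 := homogeneousComponent_eq_self hu
    rw [show n - e = e + (n - 2 * e) by omega, hc_mul hb] at h1
    simp only [LinearMap.mulLeft_apply]
    rw [mul_assoc, h1]
  have f1 := Submodule.finrank_sup_add_finrank_inf_eq A B
  have f2 := Submodule.finrank_mono hsup
  have f3 := Submodule.finrank_mono hinf
  have f4 := hilb_add f n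
  omega

lemma choose6 (k : ℕ) (y : ℝ) (hy : (k : ℝ) + 2 = y) :
    6 * (((k + 3).choose 3 : ℕ) : ℝ) = y ^ 3 - y := by
  subst hy
  have h := Nat.cast_choose_eq_ascPochhammer_div ℝ (k + 3) 3
  rw [h]
  simp [ascPochhammer_succ_right, Nat.factorial]
  ring

lemma lin_zero (a M : ℝ) (N : ℕ) (h : ∀ t : ℕ, N ≤ t → |a| * t ≤ M) : a = 0 := by
  by_contra ha
  have ha' : 0 < |a| := abs_pos.2 ha
  obtain ⟨m, hm⟩ := exists_nat_gt (M / |a|)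
  have h1 := h (max m N) (le_max_right _ _)
  have h2 : (m : ℝ) ≤ (max m N : ℕ) := by exact_mod_cast le_max_left m N
  rw [div_lt_iff₀ ha'] at hm
  nlinarith

lemma cubic_zero (a b c k C : ℝ) (N : ℕ)
    (h : ∀ t : ℕ, N ≤ t → |a * t ^ 3 + b * t ^ 2 + c * t + k| ≤ C * t) : a = 0 ∧ b = 0 := by
  have ha : a = 0 := by
    refine lin_zero a (|C| + |b| + |c| + |k|) (N + 1) fun t ht => ?_
    have h1 := h t (by omega)
    have ht1 : (1 : ℝ) ≤ t := by exact_mod_cast (by omega : 1 ≤ t)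
    have h2 : |a| * t ^ 3 ≤ C * t + |b| * t ^ 2 + |c| * t + |k| := by
      have e1 : |a| * t ^ 3 = |a * t ^ 3| := by rw [abs_mul, abs_pow, Nat.abs_cast]
      have e2 : |b| * t ^ 2 = |b * t ^ 2| := by rw [abs_mul, abs_pow, Nat.abs_cast]
      have e3 : |c| * t = |c * t| := by rw [abs_mul, Nat.abs_cast]
      rw [e1, e2, e3]
      rw [show a * (t : ℝ) ^ 3 = (a * t ^ 3 + b * t ^ 2 + c * t + k) - (b * t ^ 2) - (c * t) - k by ring]
      have i1 := abs_sub (a * t ^ 3 + b * t ^ 2 + c * t + k - (b * t ^ 2) - (c * t)) k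
      have i2 := abs_sub (a * t ^ 3 + b * t ^ 2 + c * t + k - (b * t ^ 2)) (c * t)
      have i3 := abs_sub (a * t ^ 3 + b * t ^ 2 + c * t + k) (b * t ^ 2)
      linarith
    have ht2 : (t : ℝ) ≤ t ^ 2 := by nlinarith
    have j1 : C * t ≤ |C| * t ^ 2 :=
      (mul_le_mul_of_nonneg_right (le_abs_self C) (by positivity)).trans
        (mul_le_mul_of_nonneg_left ht2 (abs_nonneg _))
    have j2 : |c| * t ≤ |c| * t ^ 2 := mul_le_mul_of_nonneg_left ht2 (abs_nonneg _)
    have j3 : |k| ≤ |k| * t ^ 2 := le_mul_of_one_le_right (abs_nonneg _) (by nlinarith)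
    have : (|a| * t) * (t : ℝ) ^ 2 ≤ (|C| + |b| + |c| + |k|) * t ^ 2 := by nlinarith
    exact le_of_mul_le_mul_right this (by positivity)
  refine ⟨ha, ?_⟩
  subst ha
  refine lin_zero b (|C| + |c| + |k|) (N + 1) fun t ht => ?_
  have h1 := h t (by omega)
  have ht1 : (1 : ℝ) ≤ t := by exact_mod_cast (by omega : 1 ≤ t)
  have h2 : |b| * t ^ 2 ≤ C * t + |c| * t + |k| := by
    have e2 : |b| * t ^ 2 = |b * t ^ 2| := by rw [abs_mul, abs_pow, Nat.abs_cast]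
    have e3 : |c| * t = |c * t| := by rw [abs_mul, Nat.abs_cast]
    rw [e2, e3]
    rw [show b * (t : ℝ) ^ 2 = (0 * t ^ 3 + b * t ^ 2 + c * t + k) - (c * t) - k by ring]
    have i1 := abs_sub (0 * t ^ 3 + b * t ^ 2 + c * t + k - (c * t)) k
    have i2 := abs_sub (0 * t ^ 3 + b * t ^ 2 + c * t + k) (c * t)
    linarith
  have j1 : C * t ≤ |C| * t := mul_le_mul_of_nonneg_right (le_abs_self C) (by positivity)
  have j3 : |k| ≤ |k| * t := le_mul_of_one_le_right (abs_nonneg _) ht1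
  have : (|b| * t) * (t : ℝ) ≤ (|C| + |c| + |k|) * t := by nlinarith
  exact le_of_mul_le_mul_right this (by positivity)

/-- Theorem 1 (2), first part: `X` has at most isolated singularities iff
`(d−1)² + Σ dᵢ² − Σ cⱼ² + Σ bₖ² = 0`. -/
theorem stmt1 (f : S4) (d : ℕ) (hd : 3 ≤ d) (hhom : f.IsHomogeneous d) (hred : Squarefree f)
    (p q r : ℕ) (hp : 3 ≤ p)
    (dd : Fin p → ℕ) (cc : Fin q → ℕ) (bb : Fin r → ℕ)
    (hddpos : ∀ i, 0 < dd i) (hccpos : ∀ j, 0 < cc j) (hbbpos : ∀ k, 0 < bb k)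
    (hddmono : Monotone dd) (hccmono : Monotone cc) (hbbmono : Monotone bb)
    (R : JacRes f dd cc bb) :
    (singLocus f).Finite ↔
      ((d : ℤ) - 1) ^ 2 + (∑ i, (dd i : ℤ) ^ 2) - (∑ j, (cc j : ℤ) ^ 2)
        + (∑ k, (bb k : ℤ) ^ 2) = 0 := by
  have he : ∀ i, (pderiv i f).IsHomogeneous (d - 1) := fun i => hhom.pderiv
  have hd0 : d ≠ 0 := by omega
  set e := d - 1 with hed
  have hde : ((d : ℤ) - 1) = (e : ℤ) := by omega
  set Z : ℤ := ((d : ℤ) - 1) ^ 2 + (∑ i, (dd i : ℤ) ^ 2) - (∑ j, (cc j : ℤ) ^ 2)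
        + (∑ k, (bb k : ℤ) ^ 2) with hZ
  set Q0 : ℝ := 1 - 4 + p - q + r with hQ0
  set Q1 : ℝ := -e + ∑ i, (dd i : ℝ) - ∑ i, (cc i : ℝ) + ∑ i, (bb i : ℝ) with hQ1
  set Q3 : ℝ := -e ^ 3 + ∑ i, (dd i : ℝ) ^ 3 - ∑ i, (cc i : ℝ) ^ 3 + ∑ i, (bb i : ℝ) ^ 3 with hQ3
  let N := 2 * e + 2 + ∑ i, dd i + ∑ i, cc i + ∑ i, bb i
  have main : ∀ t : ℕ, N ≤ t → 6 * (hilb f (t + e - 2) : ℝ) =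
      Q0 * t ^ 3 + (-3 * Q1) * t ^ 2 + (3 * Z - Q0) * t + (Q1 - Q3) := by
    intro t ht
    have g1 : ∀ i, dd i ≤ ∑ i, dd i := fun i =>
      Finset.single_le_sum (f := dd) (fun _ _ => Nat.zero_le _) (Finset.mem_univ i)
    have g2 : ∀ i, cc i ≤ ∑ i, cc i := fun i =>
      Finset.single_le_sum (f := cc) (fun _ _ => Nat.zero_le _) (Finset.mem_univ i)
    have g3 : ∀ i, bb i ≤ ∑ i, bb i := fun i =>
      Finset.single_le_sum (f := bb) (fun _ _ => Nat.zero_le _) (Finset.mem_univ i)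
    have hE := euler_char he R (t + e - 2) (by omega)
      (fun i => by have := g1 i; omega) (fun i => by have := g2 i; omega)
      (fun i => by have := g3 i; omega)
    have hE' : (hilb f (t + e - 2) : ℝ) + 4 * ((t + e - 2 - e + 3).choose 3 : ℕ)
        + ∑ j, (((t + e - 2 - (e + cc j) + 3).choose 3 : ℕ) : ℝ)
        = ((t + e - 2 + 3).choose 3 : ℕ) + ∑ i, (((t + e - 2 - (e + dd i) + 3).choose 3 : ℕ) : ℝ)
        + ∑ k, (((t + e - 2 - (e + bb k) + 3).choose 3 : ℕ) : ℝ) := by exact_mod_cast hE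
    have c0 := choose6 (t + e - 2) (t + e) (by push_cast [show 2 ≤ t + e by omega]; ring)
    have c1 := choose6 (t + e - 2 - e) t
      (by rw [show t + e - 2 - e = t - 2 by omega]; push_cast [show 2 ≤ t by omega]; ring)
    have aux : ∀ s : ℕ, s + 2 ≤ t → 6 * (((t + e - 2 - (e + s) + 3).choose 3 : ℕ) : ℝ)
        = (t ^ 3 - t) - 3 * t ^ 2 * s + 3 * t * s ^ 2 - s ^ 3 + s := by
      intro s hs
      rw [choose6 (t + e - 2 - (e + s)) (t - s) (by
        rw [show t + e - 2 - (e + s) = t - (s + 2) by omega]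
        push_cast [hs]; ring)]
      ring
    have auxs : ∀ {m : ℕ} (w : Fin m → ℕ), (∀ i, w i + 2 ≤ t) →
        6 * ∑ i, (((t + e - 2 - (e + w i) + 3).choose 3 : ℕ) : ℝ)
        = m * (t ^ 3 - t) - 3 * t ^ 2 * ∑ i, (w i : ℝ) + 3 * t * ∑ i, (w i : ℝ) ^ 2
          - ∑ i, (w i : ℝ) ^ 3 + ∑ i, (w i : ℝ) := by
      intro m w hw
      rw [Finset.mul_sum, Finset.sum_congr rfl fun i _ => aux (w i) (hw i)]
      simp only [Finset.sum_add_distrib, Finset.sum_sub_distrib, ← Finset.mul_sum,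
        Finset.sum_const, Finset.card_univ, Fintype.card_fin, nsmul_eq_mul]
      ring
    have s1 := auxs dd (fun i => by have := g1 i; omega)
    have s2 := auxs cc (fun i => by have := g2 i; omega)
    have s3 := auxs bb (fun i => by have := g3 i; omega)
    have hZr : (Z : ℝ) = (e : ℝ) ^ 2 + ∑ i, (dd i : ℝ) ^ 2 - ∑ i, (cc i : ℝ) ^ 2
        + ∑ i, (bb i : ℝ) ^ 2 := by
      rw [hZ, hde]; push_cast; ring
    rw [hZr, hQ0, hQ1, hQ3]
    linear_combination 6 * hE' - 4 * c1 - s2 + c0 + s1 + s3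
  have lin : ∀ t : ℕ, N ≤ t → (hilb f (t + e - 2) : ℝ) ≤ e ^ 2 * t := by
    intro t ht
    have hL := lin_bound hd0 hhom hred (t + e - 2) (by omega)
    have hL' : (hilb f (t + e - 2) : ℝ) + 2 * ((t + e - 2 - e + 3).choose 3 : ℕ) ≤
      ((t + e - 2 + 3).choose 3 : ℕ) + ((t + e - 2 - 2 * e + 3).choose 3 : ℕ) := by exact_mod_cast hL
    have c0 := choose6 (t + e - 2) (t + e) (by push_cast [show 2 ≤ t + e by omega]; ring)
    have c1 := choose6 (t + e - 2 - e) t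
      (by rw [show t + e - 2 - e = t - 2 by omega]; push_cast [show 2 ≤ t by omega]; ring)
    have c2 := choose6 (t + e - 2 - 2 * e) (t - e)
      (by rw [show t + e - 2 - 2 * e = t - (2 + e) by omega]; push_cast [show 2 + e ≤ t by omega]; ring)
    linarith
  obtain ⟨hq0, hq1⟩ := cubic_zero Q0 (-3 * Q1) (3 * Z - Q0) (Q1 - Q3) (6 * e ^ 2) N fun t ht => by
    rw [← main t ht, abs_of_nonneg (by positivity)]
    have := lin t ht
    linarith
  have main' : ∀ t : ℕ, N ≤ t → 6 * (hilb f (t + e - 2) : ℝ) = (3 * Z) * t + (Q1 - Q3) := by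
    intro t ht
    rw [main t ht, hq1, hq0]; ring
  constructor
  · intro hfin
    obtain ⟨B, hB⟩ := finite_bounded he hfin
    have h0 : (3 * (Z : ℝ)) = 0 := lin_zero _ (6 * B + |Q1 - Q3|) N fun t ht => by
      have h1 := main' t ht
      have h2 : (hilb f (t + e - 2) : ℝ) ≤ B := by exact_mod_cast hB _
      have h3 : (3 * (Z : ℝ)) * t = 6 * (hilb f (t + e - 2) : ℝ) - (Q1 - Q3) := by linarith
      have h4 : |3 * (Z : ℝ)| * t = |(3 * (Z : ℝ)) * t| := by
        rw [abs_mul (3 * (Z : ℝ)) t, Nat.abs_cast]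
      rw [h4, h3]
      refine (abs_sub _ _).trans ?_
      rw [abs_of_nonneg (by positivity)]
      linarith
    have : (Z : ℝ) = 0 := by linarith
    exact_mod_cast this
  · intro h0
    refine bounded_finite f (hilb f (N + e - 2)) (N + e - 2) fun n hn => ?_
    have h1 := main' N le_rfl
    have h2 := main' (n + 2 - e) (by omega)
    rw [h0] at h1 h2
    rw [show n + 2 - e + e - 2 = n by omega] at h2
    have : (hilb f n : ℝ) = hilb f (N + e - 2) := by
      simp only [Int.cast_zero, mul_zero, zero_mul] at h1 h2
      linarith
    exact le_of_eq (by exact_mod_cast this)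
end
end

section
/- Let f ∈ S = ℂ[x,y,z,t] be a reduced (squarefree) homogeneous polynomial of degree d, and let ρ_1, ρ_2, ρ_3 ∈ S⁴ be Jacobian syzygies of f whose components are homogeneous of degrees d_1, d_2, d_3 respectively. Let M be the 4×4 matrix over S whose first row is (x,y,z,t) and whose (j+1)-st row is ρ_j for j = 1,2,3, and set g = det M. If ρ_1, ρ_2, ρ_3 are linearly independent over the fraction field K = ℂ(x,y,z,t) (equivalently, g ≠ 0), then f divides g in S; in particular 1 + d_1 + d_2 + d_3 ≥ d, i.e., t(X) = d_1 + d_2 + d_3 + 1 − d ≥ 0. -/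
open MvPolynomial

noncomputable section

/-- `ρ ∈ S⁴` is a Jacobian syzygy of `f`. -/
def isSyzygy (f : S4) (ρ : Fin 4 → S4) : Prop := ∑ i, ρ i * pderiv i f = 0

lemma aux_pderiv_zero (p : S4) (i : Fin 4) (h : p ∣ pderiv i p) : pderiv i p = 0 := by
  by_contra hne
  have h1 := totalDegree_le_of_dvd_of_isDomain h hne
  obtain ⟨m, hm, hmd⟩ := Finset.exists_mem_eq_sup (pderiv i p).support
    (support_nonempty.mpr hne) (fun s => s.sum fun _ e => e)
  have hm' : coeff m (pderiv i p) ≠ 0 := mem_support_iff.mp hm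
  rw [coeff_pderiv] at hm'
  have h2 := le_totalDegree (mem_support_iff.mpr (left_ne_zero_of_mul hm'))
  have h3 : (pderiv i p).totalDegree = m.sum fun _ e => e := hmd
  rw [Finsupp.sum_add_index' (by simp) (by simp)] at h2
  simp at h2
  omega

lemma aux_const (p : S4) (h : ∀ i, pderiv i p = 0) : p = C (coeff 0 p) := by
  ext m
  rw [coeff_C]
  split_ifs with h0
  · rw [h0]
  · obtain ⟨i, hi⟩ : ∃ i, m i ≠ 0 := by
      by_contra hc
      push Not at hc
      exact h0 (Finsupp.ext fun i => by simp [hc i])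
    have h1 := coeff_pderiv (i := i) p (m - Finsupp.single i 1)
    have h2 : m - Finsupp.single i 1 + Finsupp.single i 1 = m := by
      apply tsub_add_cancel_of_le
      simpa using Nat.one_le_iff_ne_zero.mpr hi
    rw [h i, h2, coeff_zero] at h1
    rcases mul_eq_zero.mp h1.symm with h3 | h3
    · exact h3
    · exact absurd h3 (Nat.cast_add_one_ne_zero _)

lemma aux_exists (p : S4) (hp : Prime p) : ∃ i, ¬ p ∣ pderiv i p := by
  by_contra hc
  push Not at hc
  have h := aux_const p fun i => aux_pderiv_zero p i (hc i)
  apply hp.not_isUnit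
  rw [h]
  apply IsUnit.map
  rw [isUnit_iff_ne_zero]
  intro h0
  rw [h0, C_0] at h
  exact hp.ne_zero h

lemma aux_sqf (g a : S4) (ha : Squarefree a) (h : ∀ p, Prime p → p ∣ a → p ∣ g) : a ∣ g := by
  induction a using UniqueFactorizationMonoid.induction_on_prime with
  | h₁ => exact absurd ha not_squarefree_zero
  | h₂ x hx => exact hx.dvd
  | h₃ a p ha0 hp ih =>
    obtain ⟨c, rfl⟩ := ih (ha.squarefree_of_dvd (dvd_mul_left _ _))
      fun q hq hqa => h q hq (hqa.mul_left _)
    rcases hp.dvd_or_dvd (h p hp (dvd_mul_right _ _)) with h1 | h1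
    · exact absurd (ha p (mul_dvd_mul_left p h1)) hp.not_isUnit
    · rw [mul_comm]
      exact mul_dvd_mul_left a h1

lemma aux_row (f p : S4) (hp : Prime p) (hf : Squarefree f) (hpf : p ∣ f) (v : Fin 4 → S4)
    (hv : f ∣ ∑ i, v i * pderiv i f) : p ∣ ∑ i, v i * pderiv i p := by
  obtain ⟨h, rfl⟩ := hpf
  have e : ∑ i, v i * pderiv i (p * h)
      = (∑ i, v i * pderiv i p) * h + p * ∑ i, v i * pderiv i h := by
    rw [Finset.sum_mul, Finset.mul_sum, ← Finset.sum_add_distrib]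
    refine Finset.sum_congr rfl fun i _ => ?_
    rw [pderiv_mul]; ring
  have h1 := (dvd_mul_right p h).trans hv
  rw [e, dvd_add_left (dvd_mul_right _ _)] at h1
  rcases hp.dvd_or_dvd h1 with h2 | h2
  · exact h2
  · exact absurd (hf p (mul_dvd_mul_left p h2)) hp.not_isUnit

/-- Proposition propT: if `ρ₁, ρ₂, ρ₃` are Jacobian syzygies of a reduced
`f`, homogeneous of degrees `d₁, d₂, d₃`, and the determinant `g` of the matrix with rows
`(x,y,z,t), ρ₁, ρ₂, ρ₃` is nonzero (i.e. `ρ₁, ρ₂, ρ₃` are independent over `ℂ(x,y,z,t)`),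
then `f ∣ g`; in particular `1 + d₁ + d₂ + d₃ ≥ d`, i.e. `t(X) = d₁+d₂+d₃+1−d ≥ 0`. -/
theorem stmt7 (f : S4) (d : ℕ) (hhom : f.IsHomogeneous d) (hred : Squarefree f)
    (d1 d2 d3 : ℕ) (ρ1 ρ2 ρ3 : Fin 4 → S4)
    (hs1 : isSyzygy f ρ1) (hs2 : isSyzygy f ρ2) (hs3 : isSyzygy f ρ3)
    (hh1 : ∀ i, (ρ1 i).IsHomogeneous d1) (hh2 : ∀ i, (ρ2 i).IsHomogeneous d2)
    (hh3 : ∀ i, (ρ3 i).IsHomogeneous d3)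
    (hg : (Matrix.of ![fun j : Fin 4 => X j, ρ1, ρ2, ρ3]).det ≠ 0) :
    f ∣ (Matrix.of ![fun j : Fin 4 => X j, ρ1, ρ2, ρ3]).det ∧ d ≤ 1 + d1 + d2 + d3 := by
  have hrow : ∀ k, f ∣ ∑ i, (Matrix.of ![fun j : Fin 4 => X j, ρ1, ρ2, ρ3]) k i * pderiv i f := by
    intro k
    fin_cases k
    · have := hhom.sum_X_mul_pderiv
      simp only [Fin.zero_eta, Matrix.of_apply, Matrix.cons_val_zero]
      rw [this, nsmul_eq_mul]
      exact dvd_mul_left _ _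
    · exact (show _ = (0 : S4) from hs1) ▸ dvd_zero f
    · exact (show _ = (0 : S4) from hs2) ▸ dvd_zero f
    · exact (show _ = (0 : S4) from hs3) ▸ dvd_zero f
  have hdeg : (Matrix.of ![fun j : Fin 4 => X j, ρ1, ρ2, ρ3]).det.IsHomogeneous
      (1 + d1 + d2 + d3) := by
    rw [← Matrix.det_transpose, Matrix.det_apply]
    refine IsHomogeneous.sum _ _ _ fun σ _ => ?_
    rw [← mem_homogeneousSubmodule, Units.smul_def]
    refine zsmul_mem ?_ _
    rw [mem_homogeneousSubmodule, Fin.prod_univ_four]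
    exact (((isHomogeneous_X _ _).mul (hh1 _)).mul (hh2 _)).mul (hh3 _)
  generalize (Matrix.of ![fun j : Fin 4 => X j, ρ1, ρ2, ρ3]) = M at *
  have hdvd : f ∣ M.det := by
    refine aux_sqf _ _ hred fun p hp hpf => ?_
    obtain ⟨j, hj⟩ := aux_exists p hp
    have h1 : ∀ k, p ∣ M.mulVec (fun i => pderiv i p) k := fun k =>
      aux_row f p hp hred hpf (M k) (hrow k)
    have h2 : M.adjugate.mulVec (M.mulVec fun i => pderiv i p) j = M.det * pderiv j p := by
      rw [Matrix.mulVec_mulVec, Matrix.adjugate_mul, Matrix.smul_mulVec, Matrix.one_mulVec]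
      simp
    have h3 : p ∣ M.det * pderiv j p := by
      rw [← h2]
      simp only [Matrix.mulVec, dotProduct] at h1 ⊢
      exact Finset.dvd_sum fun k _ => (h1 k).mul_left _
    exact (hp.dvd_or_dvd h3).resolve_right hj
  refine ⟨hdvd, ?_⟩
  have := totalDegree_le_of_dvd_of_isDomain hdvd hg
  rwa [hhom.totalDegree hred.ne_zero, hdeg.totalDegree hg] at this
end
end
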